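/- arXiv:1910.11931 — 3 statements merged into one kernel-verified Lean document; each statement's English description precedes it below -/
import Mathlib

section
/- Let d ≥ 1 and let a_0,…,a_d and b_0,…,b_d be points in ℝ^d. For ς ∈ ℝ set p_i(ς) = (1−ς)·a_i + ς·b_i and v_i = b_i − a_i, and let E(ς) be the d×d real matrix whose j-th column is p_j(ς) − p_0(ς) for j = 1,…,d. For j = 1,…,d define w_j(ς,x) = (E(ς)^{-1} (x − p_0(ς)))_j, define w_0(ς,x) = 1 − Σ_{j=1}^d w_j(ς,x), and define the velocity field Ẋ(ς,x) = Σ_{i=0}^d v_i · w_i(ς,x). Then for every ς_0 at which E(ς_0) is invertible, for every x ∈ ℝ^d and every i ∈ {0,…,d}, the function ς ↦ w_i(ς,x) is differentiable at ς_0 and its derivative equals −∇_x w_i(ς_0,x) · Ẋ(ς_0,x), where ∇_x w_i(ς_0,·) is the (constant-in-x) spatial gradient of the affine function x ↦ w_i(ς_0,x). -/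
open Matrix

theorem Matrix.differentiableAt_det {n : Type*} [Fintype n] [DecidableEq n]
    {A : ℝ → Matrix n n ℝ} {t : ℝ} (hA : ∀ i j, DifferentiableAt ℝ (fun s => A s i j) t) :
    DifferentiableAt ℝ (fun s => (A s).det) t := by
  simp only [Matrix.det_apply']
  fun_prop

theorem Matrix.differentiableAt_inv_mulVec {n : Type*} [Fintype n] [DecidableEq n]
    {A : ℝ → Matrix n n ℝ} {y : ℝ → n → ℝ} {t : ℝ}
    (hA : ∀ i j, DifferentiableAt ℝ (fun s => A s i j) t)
    (hy : ∀ i, DifferentiableAt ℝ (fun s => y s i) t) (ht : IsUnit (A t).det) (i : n) :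
    DifferentiableAt ℝ (fun s => ((A s)⁻¹ *ᵥ y s) i) t := by
  have h : ∀ s, ((A s)⁻¹ *ᵥ y s) i = (A s).det⁻¹ * ((A s).updateCol i (y s)).det := by
    intro s
    rw [Matrix.inv_def, Matrix.smul_mulVec, ← Matrix.cramer_eq_adjugate_mulVec,
      Ring.inverse_eq_inv', Pi.smul_apply, Matrix.cramer_apply, smul_eq_mul]
  simp only [h]
  refine ((differentiableAt_det hA).inv ht.ne_zero).mul (differentiableAt_det fun k l => ?_)
  by_cases hl : l = i
  · simpa [Matrix.updateCol_apply, hl] using hy k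
  · simpa [Matrix.updateCol_apply, hl] using hA k l

theorem Matrix.hasDerivAt_inv_mulVec {n : Type*} [Fintype n] [DecidableEq n]
    {A : ℝ → Matrix n n ℝ} {A' : Matrix n n ℝ} {y : ℝ → n → ℝ} {y' : n → ℝ} {t : ℝ}
    (hA : ∀ i j, HasDerivAt (fun s => A s i j) (A' i j) t)
    (hy : ∀ i, HasDerivAt (fun s => y s i) (y' i) t) (ht : IsUnit (A t).det) (i : n) :
    HasDerivAt (fun s => ((A s)⁻¹ *ᵥ y s) i)
      (((A t)⁻¹ *ᵥ (y' - A' *ᵥ ((A t)⁻¹ *ᵥ y t))) i) t := by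
  have hu : ∀ j, HasDerivAt (fun s => ((A s)⁻¹ *ᵥ y s) j)
      (deriv (fun s => ((A s)⁻¹ *ᵥ y s) j) t) t := fun j =>
    (differentiableAt_inv_mulVec (fun k l => (hA k l).differentiableAt)
      (fun k => (hy k).differentiableAt) ht j).hasDerivAt
  set u' : n → ℝ := fun j => deriv (fun s => ((A s)⁻¹ *ᵥ y s) j) t
  have hunit : ∀ᶠ s in nhds t, (A s).det ≠ 0 :=
    (differentiableAt_det fun k l => (hA k l).differentiableAt).continuousAt.eventually_ne
      ht.ne_zero
  have hprod : A' *ᵥ ((A t)⁻¹ *ᵥ y t) + A t *ᵥ u' = y' := by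
    ext k
    have h1 : HasDerivAt (fun s => (A s *ᵥ ((A s)⁻¹ *ᵥ y s)) k)
        ((A' *ᵥ ((A t)⁻¹ *ᵥ y t) + A t *ᵥ u') k) t := by
      have h := HasDerivAt.fun_sum (u := Finset.univ) fun l _ => (hA k l).mul (hu l)
      rw [Finset.sum_add_distrib] at h
      exact h
    refine h1.unique ((hy k).congr_of_eventuallyEq ?_)
    filter_upwards [hunit] with s hs
    rw [Matrix.mulVec_mulVec, Matrix.mul_nonsing_inv _ hs.isUnit, Matrix.one_mulVec]
  have hu' : (A t)⁻¹ *ᵥ (y' - A' *ᵥ ((A t)⁻¹ *ᵥ y t)) = u' := by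
    rw [← hprod, add_sub_cancel_left, Matrix.mulVec_mulVec, Matrix.nonsing_inv_mul _ ht,
      Matrix.one_mulVec]
  rw [hu']
  exact hu i

/-- Identity (8) of the paper, `∂φ/∂ς = −∇φ·Ẋ`, for the linear nodal basis
functions (barycentric coordinates) of a simplex whose vertices move linearly
in the pseudo-time `ς` from `a i` to `b i`. Here `p i ς = (1−ς)·a i + ς·b i`,
`v i = b i − a i`, `E ς` has columns `p j ς − p 0 ς` (`j = 1, …, d`),
`W ς x` are the barycentric coordinates `w₀, …, w_d`, and
`Ẋ(ς, x) = ∑ i, w_i(ς, x) • v i` is the velocity field. For every `ς₀` at which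
`E ς₀` is invertible, every `x` and every `i`, there is a (unique) constant spatial
gradient `g` of the affine map `x ↦ w_i(ς₀, x)`, and `ς ↦ w_i(ς, x)` is
differentiable at `ς₀` with derivative `−g ⬝ᵥ Ẋ(ς₀, x)`. -/
theorem barycentric_pseudo_time_derivative (d : ℕ) (hd : 1 ≤ d)
    (a b : Fin (d + 1) → Fin d → ℝ)
    (p : Fin (d + 1) → ℝ → Fin d → ℝ)
    (hp : ∀ i ς, p i ς = (1 - ς) • a i + ς • b i)
    (v : Fin (d + 1) → Fin d → ℝ) (hv : ∀ i, v i = b i - a i)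
    (E : ℝ → Matrix (Fin d) (Fin d) ℝ)
    (hE : ∀ ς (i j : Fin d), E ς i j = p j.succ ς i - p 0 ς i)
    (W : ℝ → (Fin d → ℝ) → Fin (d + 1) → ℝ)
    (hWsucc : ∀ ς x (j : Fin d), W ς x j.succ = ((E ς)⁻¹ *ᵥ (x - p 0 ς)) j)
    (hW0 : ∀ ς x, W ς x 0 = 1 - ∑ j : Fin d, ((E ς)⁻¹ *ᵥ (x - p 0 ς)) j)
    (Xdot : ℝ → (Fin d → ℝ) → Fin d → ℝ)
    (hX : ∀ ς x, Xdot ς x = ∑ i : Fin (d + 1), W ς x i • v i)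
    (ς₀ : ℝ) (hς₀ : IsUnit (E ς₀).det) :
    ∀ (x : Fin d → ℝ) (i : Fin (d + 1)),
      ∃ g : Fin d → ℝ,
        (∀ y z : Fin d → ℝ, W ς₀ z i - W ς₀ y i = g ⬝ᵥ (z - y)) ∧
        HasDerivAt (fun ς => W ς x i) (-(g ⬝ᵥ Xdot ς₀ x)) ς₀ := by
  intro x i
  have hpd : ∀ i k, HasDerivAt (fun ς => p i ς k) (v i k) ς₀ := by
    intro i k
    simp only [hp, hv, Pi.add_apply, Pi.smul_apply, Pi.sub_apply, smul_eq_mul]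
    exact ((((hasDerivAt_id ς₀).const_sub 1).mul_const (a i k)).add
      ((hasDerivAt_id ς₀).mul_const (b i k))).congr_deriv (by ring)
  have hEd : ∀ k j : Fin d, HasDerivAt (fun ς => E ς k j)
      (Matrix.of (fun k j : Fin d => v j.succ k - v 0 k) k j) ς₀ := by
    intro k j
    simp only [hE]
    exact (hpd j.succ k).sub (hpd 0 k)
  have hyd : ∀ k, HasDerivAt (fun ς => (x - p 0 ς) k) ((-v 0) k) ς₀ := fun k =>
    (hpd 0 k).const_sub (x k)
  have hXdot : -v 0 - Matrix.of (fun k j : Fin d => v j.succ k - v 0 k) *ᵥ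
      ((E ς₀)⁻¹ *ᵥ (x - p 0 ς₀)) = -Xdot ς₀ x := by
    ext k
    simp only [hX, Fin.sum_univ_succ, hW0, hWsucc]
    generalize (E ς₀)⁻¹ *ᵥ (x - p 0 ς₀) = u
    simp only [Pi.sub_apply, Pi.neg_apply, Pi.add_apply, Pi.smul_apply, Finset.sum_apply,
      smul_eq_mul, Matrix.mulVec, dotProduct, Matrix.of_apply, sub_mul, Finset.sum_sub_distrib,
      ← Finset.mul_sum, one_mul, mul_comm (u _)]
    ring
  have hu : ∀ j, HasDerivAt (fun ς => ((E ς)⁻¹ *ᵥ (x - p 0 ς)) j)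
      (-((E ς₀)⁻¹ *ᵥ Xdot ς₀ x) j) ς₀ := by
    intro j
    have h := Matrix.hasDerivAt_inv_mulVec hEd hyd hς₀ j
    rwa [hXdot, Matrix.mulVec_neg] at h
  have hdiff : ∀ (y z : Fin d → ℝ) (j : Fin d), ((E ς₀)⁻¹ *ᵥ (z - p 0 ς₀)) j -
      ((E ς₀)⁻¹ *ᵥ (y - p 0 ς₀)) j = ((E ς₀)⁻¹ *ᵥ (z - y)) j := by
    intro y z j
    rw [← Pi.sub_apply, ← Matrix.mulVec_sub, sub_sub_sub_cancel_right]
  cases i using Fin.cases with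
  | zero =>
    have hg : ∀ w : Fin d → ℝ, (-∑ j, (E ς₀)⁻¹.row j) ⬝ᵥ w = -∑ j, ((E ς₀)⁻¹ *ᵥ w) j := by
      intro w
      rw [neg_dotProduct, sum_dotProduct]
      rfl
    refine ⟨-∑ j, (E ς₀)⁻¹.row j, fun y z => ?_, ?_⟩
    · rw [hg, hW0, hW0, sub_sub_sub_cancel_left, ← Finset.sum_sub_distrib,
        ← Finset.sum_neg_distrib]
      refine Finset.sum_congr rfl fun j _ => ?_
      rw [← hdiff y z, neg_sub]
    · rw [hg, ← Finset.sum_neg_distrib]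
      simp only [hW0]
      exact (HasDerivAt.fun_sum fun j _ => hu j).const_sub 1
  | succ j =>
    refine ⟨(E ς₀)⁻¹.row j, fun y z => ?_, ?_⟩
    · rw [hWsucc, hWsucc]
      exact hdiff y z j
    · simp only [hWsucc]
      exact hu j
end

section
/- One-dimensional fully discrete mass conservation. Define the local Lax–Friedrichs flux in one dimension by F(a, b; s, n, α) = ½( −(a + b)·s·n − α·(b − a) ) for a, b, s, α ∈ ℝ and n ∈ {−1, +1}. Let N ≥ 1 and consider cells i = 1,…,N separated by interfaces j = 0,…,N. At interface j let l_j, r_j ∈ ℝ be the traces from the left and right cells, let s_j ∈ ℝ be the interface velocity and α_j ∈ ℝ the penalty parameter, with s_0 = s_N = 0 and α_0 = α_N = 0 (the domain boundary does not move). Let M_i ∈ ℝ be the mass of cell i, let Δς ∈ ℝ, and define the updated masses M_i′ = M_i − Δς·( F(l_i, r_i; s_i, +1, α_i) + F(r_{i−1}, l_{i−1}; s_{i−1}, −1, α_{i−1}) ). Then Σ_{i=1}^N M_i′ = Σ_{i=1}^N M_i. -/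
/-- The one-dimensional local Lax–Friedrichs numerical flux
`F(a, b; s, n, α) = ½( −(a + b)·s·n − α·(b − a) )`. -/
noncomputable def llfFlux1 (a b s n α : ℝ) : ℝ :=
  (1 / 2) * (-(a + b) * s * n - α * (b - a))

/-- The flux is conservative: seen from the other side of an interface it changes sign. -/
theorem llfFlux1_swap_neg (a b s n α : ℝ) :
    llfFlux1 b a s (-n) α = -llfFlux1 a b s n α := by
  unfold llfFlux1
  ring

/-- The flux vanishes on an interface with zero velocity and zero penalty. -/
theorem llfFlux1_zero_zero (a b n : ℝ) : llfFlux1 a b 0 n 0 = 0 := by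
  simp [llfFlux1]

/-- Telescoping sum over consecutive entries of a finite family. -/
theorem Fin.sum_succ_sub_castSucc {A : Type*} [AddCommGroup A] {n : ℕ} (f : Fin (n + 1) → A) :
    ∑ i : Fin n, (f i.succ - f i.castSucc) = f (Fin.last n) - f 0 := by
  rw [Finset.sum_sub_distrib, sub_eq_sub_iff_add_eq_add, add_comm, ← Fin.sum_univ_succ,
    Fin.sum_univ_castSucc, add_comm]

/-- One-dimensional fully discrete mass conservation: with `N ≥ 1` cells separated by
interfaces `j = 0, …, N`, left/right traces `l j, r j`, interface velocities `s j` and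
penalties `α j` vanishing at the domain boundary (`s 0 = s N = 0`, `α 0 = α N = 0`),
the forward-Euler update of the cell masses by the local Lax–Friedrichs fluxes
conserves the total mass. Cell `i` has right interface `i.succ` (outward normal `+1`,
interior trace `l`, exterior trace `r`) and left interface `i.castSucc`
(outward normal `−1`, interior trace `r`, exterior trace `l`). -/
theorem llf_mass_conservation (N : ℕ) (hN : 1 ≤ N)
    (l r s α : Fin (N + 1) → ℝ)
    (hs0 : s 0 = 0) (hsN : s (Fin.last N) = 0)
    (hα0 : α 0 = 0) (hαN : α (Fin.last N) = 0)
    (M M' : Fin N → ℝ) (Δς : ℝ)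
    (hupd : ∀ i : Fin N,
      M' i = M i - Δς *
        (llfFlux1 (l i.succ) (r i.succ) (s i.succ) 1 (α i.succ) +
         llfFlux1 (r i.castSucc) (l i.castSucc) (s i.castSucc) (-1) (α i.castSucc))) :
    ∑ i, M' i = ∑ i, M i := by
  have htel := Fin.sum_succ_sub_castSucc fun j => llfFlux1 (l j) (r j) (s j) 1 (α j)
  simp only [hs0, hsN, hα0, hαN, llfFlux1_zero_zero, sub_zero] at htel
  simp only [hupd, llfFlux1_swap_neg, ← sub_eq_add_neg]
  rw [Finset.sum_sub_distrib, ← Finset.mul_sum, htel, mul_zero, sub_zero]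
end

section
/- One-dimensional positivity preservation of cell averages under a CFL condition. Define the local Lax–Friedrichs flux in one dimension by F(a, b; s, n, α) = ½( −(a + b)·s·n − α·(b − a) ) for a, b, s, α ∈ ℝ and n ∈ {−1, +1}. Let n_g ≥ 2 and let ŵ_1,…,ŵ_{n_g} be positive reals with Σ_j ŵ_j = 1 and ŵ_{n_g} = ŵ_1. Let u_1,…,u_{n_g} ≥ 0 be values of the DG solution at the quadrature points of a cell, with u_1 the trace at the left endpoint and u_{n_g} the trace at the right endpoint, and set the cell average ū = Σ_j ŵ_j·u_j. Let v_l ≥ 0 and v_r ≥ 0 be the exterior traces at the left and right interfaces, let s_l, s_r ∈ ℝ be the interface velocities, and let α_l ≥ |s_l| and α_r ≥ |s_r|. Let L > 0 and L′ > 0 be the old and new cell lengths, let Δς > 0 satisfy Δς·max(α_l, α_r) ≤ ŵ_1·L, and define the updated cell average ū′ by L′·ū′ = L·ū − Δς·( F(u_{n_g}, v_r; s_r, +1, α_r) + F(u_1, v_l; s_l, −1, α_l) ). Then ū′ ≥ 0. -/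
/-- The local Lax–Friedrichs flux of nonnegative traces is at most the penalty times the
interior trace. -/
lemma llfFlux1_le_mul {a b s n α : ℝ} (ha : 0 ≤ a) (hb : 0 ≤ b) (hα : |s * n| ≤ α) :
    llfFlux1 a b s n α ≤ α * a := by
  have h := mul_nonneg (add_nonneg ha hb) (by linarith [neg_abs_le (s * n)] : 0 ≤ α + s * n)
  unfold llfFlux1
  linarith

/-- A sum of nonnegative values dominates the contribution of its two endpoints. -/
lemma endpoints_le_sum (m : ℕ) {f : Fin (m + 2) → ℝ} (hf : ∀ j, 0 ≤ f j) :
    f 0 + f (Fin.last (m + 1)) ≤ ∑ j, f j := by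
  rw [Fin.sum_univ_succ, Fin.sum_univ_castSucc, Fin.succ_last]
  linarith [Finset.sum_nonneg fun (i : Fin m) (_ : i ∈ Finset.univ) => hf i.castSucc.succ]

/-- One-dimensional positivity preservation of cell averages under a CFL condition
(Proposition 1 of the paper in one dimension). With `n_g = m + 2 ≥ 2` positive
Gauss–Lobatto weights summing to `1` with equal endpoint weights, nonnegative point
values `u j` with cell average `ū = ∑ j, ŵ j · u j`, nonnegative exterior traces
`v_l, v_r`, penalties `α_l ≥ |s_l|`, `α_r ≥ |s_r|`, positive old/new cell lengths
`L, L′`, and `Δς·max(α_l, α_r) ≤ ŵ₁·L`, the forward-Euler updated cell average `ū′`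
defined by `L′·ū′ = L·ū − Δς·(F(u_{n_g}, v_r; s_r, +1, α_r) + F(u₁, v_l; s_l, −1, α_l))`
is nonnegative. -/
theorem pp_cell_average_1d (m : ℕ)
    (w : Fin (m + 2) → ℝ) (hwpos : ∀ j, 0 < w j) (hwsum : ∑ j, w j = 1)
    (hwend : w (Fin.last (m + 1)) = w 0)
    (u : Fin (m + 2) → ℝ) (hu : ∀ j, 0 ≤ u j)
    (ubar : ℝ) (hubar : ubar = ∑ j, w j * u j)
    (vl vr : ℝ) (hvl : 0 ≤ vl) (hvr : 0 ≤ vr)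
    (sl sr αl αr : ℝ) (hαl : |sl| ≤ αl) (hαr : |sr| ≤ αr)
    (L L' : ℝ) (hL : 0 < L) (hL' : 0 < L')
    (Δς : ℝ) (hΔς : 0 < Δς) (hcfl : Δς * max αl αr ≤ w 0 * L)
    (ubar' : ℝ)
    (hupd : L' * ubar' = L * ubar -
      Δς * (llfFlux1 (u (Fin.last (m + 1))) vr sr 1 αr + llfFlux1 (u 0) vl sl (-1) αl)) :
    0 ≤ ubar' := by
  have hr := llfFlux1_le_mul (n := 1) (hu (Fin.last (m + 1))) hvr (by simpa using hαr)
  have hl := llfFlux1_le_mul (n := -1) (hu 0) hvl (by simpa using hαl)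
  have hcr : Δς * αr ≤ w 0 * L :=
    (mul_le_mul_of_nonneg_left (le_max_right αl αr) hΔς.le).trans hcfl
  have hcl : Δς * αl ≤ w 0 * L :=
    (mul_le_mul_of_nonneg_left (le_max_left αl αr) hΔς.le).trans hcfl
  have hends : w 0 * u 0 + w 0 * u (Fin.last (m + 1)) ≤ ubar := by
    have h := endpoints_le_sum m fun j => mul_nonneg (hwpos j).le (hu j)
    rwa [hwend, ← hubar] at h
  have hflux := mul_le_mul_of_nonneg_left (add_le_add hr hl) hΔς.le
  have hmass := mul_le_mul_of_nonneg_left hends hL.le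
  have hur := mul_le_mul_of_nonneg_right hcr (hu (Fin.last (m + 1)))
  have hul := mul_le_mul_of_nonneg_right hcl (hu 0)
  refine nonneg_of_mul_nonneg_right ?_ hL'
  rw [hupd]
  linarith
end
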